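/- Let a, b, u, v be unit vectors in ℝ^d with ∠(a,b) = ∠(u,v) = θ, let Π be the orthogonal projector onto span{a,b}, and suppose max{‖Πu‖₂, ‖Πv‖₂} = δ < 1. Let r ∈ ℝ^d have i.i.d. standard Gaussian entries. Then E[ ((1 − sign(⟨r,a⟩)sign(⟨r,b⟩))/2 − θ/π) · ((1 − sign(⟨r,u⟩)sign(⟨r,v⟩))/2 − θ/π) ] ≤ 2δ. -/

import Mathlib

open MeasureTheory ProbabilityTheory Real
open scoped ENNReal

noncomputable section

/-- Entrywise sign: `sgn t = 1` if `t ≥ 0`, `-1` otherwise. -/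
def sgn (t : ℝ) : ℝ := if 0 ≤ t then 1 else -1

/-- Euclidean (ℓ²) norm. -/
def l2norm {ι : Type*} [Fintype ι] (x : ι → ℝ) : ℝ := Real.sqrt (∑ i, x i ^ 2)

/-- Entrywise ℓ¹ norm. -/
def l1norm {ι : Type*} [Fintype ι] (x : ι → ℝ) : ℝ := ∑ i, |x i|

/-- Supremum (ℓ∞) norm. -/
def linf {ι : Type*} [Fintype ι] (x : ι → ℝ) : ℝ := ⨆ i, |x i|

/-- Euclidean inner product. -/
def dotp {ι : Type*} [Fintype ι] (x y : ι → ℝ) : ℝ := ∑ i, x i * y i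

/-- Angle between two vectors. -/
def angle' {ι : Type*} [Fintype ι] (x y : ι → ℝ) : ℝ :=
  Real.arccos (dotp x y / (l2norm x * l2norm y))

/-- The standard Gaussian measure on `ℝ^d` (i.i.d. `N(0,1)` coordinates). -/
def gaussPi (d : ℕ) : Measure (Fin d → ℝ) := Measure.pi fun _ => gaussianReal 0 1

/-- The Rademacher measure on `ℝ`: `±1` with probability `1/2` each. -/
def radMeasure : Measure ℝ := (2 : ℝ≥0∞)⁻¹ • (Measure.dirac 1 + Measure.dirac (-1))

instance : IsProbabilityMeasure radMeasure := by
  constructor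
  simp only [radMeasure, Measure.smul_apply, Measure.coe_add, Pi.add_apply,
    Measure.dirac_apply' _ MeasurableSet.univ, Set.indicator_univ, Pi.one_apply, smul_eq_mul]
  rw [one_add_one_eq_two, ENNReal.inv_mul_cancel] <;> simp

instance (d : ℕ) : IsProbabilityMeasure (gaussPi d) := by
  unfold gaussPi; infer_instance

/-- i.i.d. Rademacher signs on `ℝ^d`. -/
def radPi (d : ℕ) : Measure (Fin d → ℝ) := Measure.pi fun _ => radMeasure

instance (d : ℕ) : IsProbabilityMeasure (radPi d) := by
  unfold radPi; infer_instance

/-- Circular shift by `t` positions: the `j`-th entry of `shift t x` is `x ((j - t) mod d)`. -/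
def shift {d : ℕ} (t : ℕ) (x : Fin d → ℝ) : Fin d → ℝ :=
  fun j => x ⟨((j : ℕ) + (d - t % d)) % d, Nat.mod_lt _ j.pos⟩

/-- The `k`-bit circulant binary embedding: `sign` of the first `k` entries of
`circ(r) · D · x`, where `D = diag D`. -/
def cbe {d k : ℕ} (hk : k ≤ d) (r D x : Fin d → ℝ) : Fin k → ℝ :=
  fun i => sgn (∑ j, r (Fin.castLE hk i - j) * (D j * x j))


lemma iIndepFun_eval_gaussPi (d : ℕ) :
    iIndepFun (fun (i : Fin d) (r : Fin d → ℝ) ↦ r i) (gaussPi d) :=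
  iIndepFun_pi (𝓧 := fun _ ↦ ℝ) (X := fun _ x ↦ x) fun _ ↦ by fun_prop

lemma map_eval_gaussPi {d : ℕ} (i : Fin d) :
    (gaussPi d).map (fun r ↦ r i) = gaussianReal 0 1 :=
  (measurePreserving_eval (fun _ : Fin d ↦ gaussianReal 0 1) i).map_eq

lemma hasGaussianLaw_id_gaussPi (d : ℕ) : HasGaussianLaw (fun r : Fin d → ℝ ↦ r) (gaussPi d) :=
  (iIndepFun_eval_gaussPi d).hasGaussianLaw fun i ↦ ⟨by
    rw [map_eval_gaussPi]; infer_instance⟩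

lemma memLp_eval_gaussPi {d : ℕ} (i : Fin d) : MemLp (fun r : Fin d → ℝ ↦ r i) 2 (gaussPi d) :=
  ((hasGaussianLaw_id_gaussPi d).eval i).memLp_two

lemma covariance_eval_gaussPi {d : ℕ} (i j : Fin d) :
    cov[fun r ↦ r i, fun r ↦ r j; gaussPi d] = if i = j then 1 else 0 := by
  split_ifs with h
  · subst h
    rw [covariance_self (measurable_pi_apply i).aemeasurable]
    have := variance_map (μ := gaussPi d) (X := id) (Y := fun r ↦ r i)
      (by fun_prop) (measurable_pi_apply i).aemeasurable
    rw [map_eval_gaussPi, variance_id_gaussianReal] at this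
    exact_mod_cast this.symm
  · exact ((iIndepFun_eval_gaussPi d).indepFun h).covariance_eq_zero
      (memLp_eval_gaussPi i) (memLp_eval_gaussPi j)

lemma covariance_dotp {d : ℕ} (x y : Fin d → ℝ) :
    cov[fun r ↦ dotp r x, fun r ↦ dotp r y; gaussPi d] = dotp x y := by
  simp only [dotp]
  rw [covariance_fun_sum_fun_sum (fun i ↦ (memLp_eval_gaussPi i).mul_const _)
    (fun i ↦ (memLp_eval_gaussPi i).mul_const _)]
  simp [covariance_mul_const_left, covariance_mul_const_right, covariance_eval_gaussPi]

lemma integral_dotp {d : ℕ} (x : Fin d → ℝ) : ∫ r, dotp r x ∂gaussPi d = 0 := by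
  simp only [dotp]
  rw [integral_finsetSum _ fun i _ ↦ ((memLp_eval_gaussPi i).mul_const _).integrable (by norm_num)]
  refine Finset.sum_eq_zero fun i _ ↦ ?_
  rw [integral_mul_const, gaussPi, integral_eval]
  simp

@[fun_prop]
lemma measurable_dotp {d : ℕ} (x : Fin d → ℝ) : Measurable fun r : Fin d → ℝ ↦ dotp r x := by
  unfold dotp; fun_prop

lemma variance_dotp {d : ℕ} (x : Fin d → ℝ) :
    Var[fun r ↦ dotp r x; gaussPi d] = dotp x x := by
  rw [← covariance_self (by fun_prop), covariance_dotp]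

lemma dotp_add_right {d : ℕ} (r x y : Fin d → ℝ) : dotp r (x + y) = dotp r x + dotp r y :=
  dotProduct_add r x y

lemma dotp_sub_left {d : ℕ} (x y r : Fin d → ℝ) : dotp (x - y) r = dotp x r - dotp y r :=
  sub_dotProduct x y r

lemma dotp_smul_right {d : ℕ} (c : ℝ) (r x : Fin d → ℝ) : dotp r (c • x) = c * dotp r x :=
  dotProduct_smul c r x

lemma dotp_comm {d : ℕ} (x y : Fin d → ℝ) : dotp x y = dotp y x := dotProduct_comm x y

lemma hasGaussianLaw_dotp_prod {d : ℕ} (x y : Fin d → ℝ) :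
    HasGaussianLaw (fun r : Fin d → ℝ ↦ (dotp r x, dotp r y)) (gaussPi d) :=
  (hasGaussianLaw_id_gaussPi d).map_fun (LinearMap.toContinuousLinearMap
    (((dotProductBilin ℝ ℝ).flip x).prod ((dotProductBilin ℝ ℝ).flip y)))

lemma charFunDual_map_dotp_prod {d : ℕ} (a b : Fin d → ℝ) (L : StrongDual ℝ (ℝ × ℝ)) :
    charFunDual ((gaussPi d).map (fun r ↦ (dotp r a, dotp r b))) L =
      Complex.exp (-((L (1, 0)) ^ 2 * dotp a a + 2 * L (1, 0) * L (0, 1) * dotp a b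
        + (L (0, 1)) ^ 2 * dotp b b : ℝ) / 2) := by
  have hL : (fun r : Fin d → ℝ ↦ L (dotp r a, dotp r b)) =
      fun r ↦ dotp r (L (1, 0) • a + L (0, 1) • b) := by
    funext r
    have : (dotp r a, dotp r b) = dotp r a • ((1, 0) : ℝ × ℝ) + dotp r b • ((0, 1) : ℝ × ℝ) := by
      simp
    rw [this, map_add, map_smul, map_smul, dotp_add_right, dotp_smul_right, dotp_smul_right]
    simp [mul_comm]
  rw [(hasGaussianLaw_dotp_prod a b).charFunDual_map_eq_fun, hL, variance_dotp,
    integral_dotp]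
  congr 1
  have (x : Fin d → ℝ) : dotp (L (1, 0) • a + L (0, 1) • b) x =
    L (1, 0) * dotp a x + L (0, 1) * dotp b x := by
    rw [dotp_comm, dotp_add_right, dotp_smul_right, dotp_smul_right, dotp_comm x, dotp_comm x]
  rw [dotp_add_right, dotp_smul_right, dotp_smul_right, this, this, dotp_comm b a]
  push_cast
  ring

lemma map_dotp_prod_eq {d e : ℕ} {a b : Fin d → ℝ} {a' b' : Fin e → ℝ}
    (haa : dotp a a = dotp a' a') (hab : dotp a b = dotp a' b') (hbb : dotp b b = dotp b' b') :
    (gaussPi d).map (fun r ↦ (dotp r a, dotp r b)) =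
      (gaussPi e).map (fun r ↦ (dotp r a', dotp r b')) := by
  have := Measure.isProbabilityMeasure_map (μ := gaussPi d) (f := fun r ↦ (dotp r a, dotp r b))
    (by fun_prop)
  have := Measure.isProbabilityMeasure_map (μ := gaussPi e) (f := fun r ↦ (dotp r a', dotp r b'))
    (by fun_prop)
  refine Measure.ext_of_charFunDual (funext fun L ↦ ?_)
  rw [charFunDual_map_dotp_prod, charFunDual_map_dotp_prod, haa, hab, hbb]

lemma indepFun_dotp_prod {d : ℕ} {a b w z : Fin d → ℝ} (haw : dotp a w = 0) (haz : dotp a z = 0)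
    (hbw : dotp b w = 0) (hbz : dotp b z = 0) :
    IndepFun (fun r ↦ (dotp r a, dotp r b)) (fun r ↦ (dotp r w, dotp r z)) (gaussPi d) := by
  have h : HasGaussianLaw (fun r : Fin d → ℝ ↦
      ((fun i : Fin 2 ↦ dotp r (![a, b] i)), (fun i : Fin 2 ↦ dotp r (![w, z] i)))) (gaussPi d) :=
    (hasGaussianLaw_id_gaussPi d).map_fun (LinearMap.toContinuousLinearMap
      ((LinearMap.pi fun i ↦ (dotProductBilin ℝ ℝ).flip (![a, b] i)).prod
        (LinearMap.pi fun i ↦ (dotProductBilin ℝ ℝ).flip (![w, z] i))))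
  have h2 := HasGaussianLaw.indepFun_of_covariance_eval
    (X := fun (i : Fin 2) r ↦ dotp r (![a, b] i)) (Y := fun (i : Fin 2) r ↦ dotp r (![w, z] i)) h
    (fun i j ↦ by
      rw [covariance_dotp]
      fin_cases i <;> fin_cases j <;> simpa)
  exact h2.comp (φ := fun x ↦ (x 0, x 1)) (ψ := fun x ↦ (x 0, x 1)) (by fun_prop) (by fun_prop)

lemma integral_gaussianReal_prod_of_radially_const {F : ℝ × ℝ → ℝ} {g : ℝ → ℝ}
    (hF : ∀ ρ > 0, ∀ φ, F (ρ * cos φ, ρ * sin φ) = g φ) :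
    ∫ p, F p ∂((gaussianReal 0 1).prod (gaussianReal 0 1)) =
      (2 * π)⁻¹ * ∫ φ in -π..π, g φ := by
  have key {F : ℝ × ℝ → ℝ} {g : ℝ → ℝ} (hF : ∀ ρ > 0, ∀ φ, F (ρ * cos φ, ρ * sin φ) = g φ) :
      ∫ p, F p ∂((gaussianReal 0 1).prod (gaussianReal 0 1)) =
        (∫ ρ in Set.Ioi (0 : ℝ), ρ * ((2 * π)⁻¹ * exp (-ρ ^ 2 / 2))) * ∫ φ in -π..π, g φ := by
    rw [gaussianReal_of_var_ne_zero _ one_ne_zero,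
      prod_withDensity (measurable_gaussianPDF _ _) (measurable_gaussianPDF _ _),
      ← Measure.volume_eq_prod, integral_withDensity_eq_integral_toReal_smul (by fun_prop)
        (.of_forall fun _ ↦ ENNReal.mul_lt_top gaussianPDF_lt_top gaussianPDF_lt_top),
      ← integral_comp_polarCoord_symm, intervalIntegral.integral_of_le (by linarith [pi_pos]),
      integral_Ioc_eq_integral_Ioo, ← setIntegral_prod_mul, Measure.volume_eq_prod]
    refine setIntegral_congr_fun (measurableSet_Ioi.prod measurableSet_Ioo) fun p hp ↦ ?_
    have hsq : √(2 * π * 1) ≠ 0 := by positivity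
    simp only [polarCoord_symm_apply, ENNReal.toReal_mul, toReal_gaussianPDF, gaussianPDFReal,
      NNReal.coe_one, smul_eq_mul, hF _ hp.1]
    have : (√(2 * π * 1))⁻¹ * (√(2 * π * 1))⁻¹ = (2 * π)⁻¹ := by
      rw [← mul_inv, mul_self_sqrt (by positivity), mul_one]
    have he : exp (-(p.1 * cos p.2 - 0) ^ 2 / (2 * 1)) * exp (-(p.1 * sin p.2 - 0) ^ 2 / (2 * 1)) =
        exp (-p.1 ^ 2 / 2) := by
      rw [← exp_add]
      congr 1
      linear_combination (-p.1 ^ 2 / 2) * sin_sq_add_cos_sq p.2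
    rw [← this, ← he]
    ring
  have h1 := key (F := fun _ ↦ 1) (g := fun _ ↦ 1) fun _ _ _ ↦ rfl
  simp only [integral_const, probReal_univ, intervalIntegral.integral_const, smul_eq_mul] at h1
  rw [key hF]
  congr 1
  exact eq_inv_of_mul_eq_one_left (by linarith)

lemma sgn_of_pos {t : ℝ} (ht : 0 < t) : sgn t = 1 := if_pos ht.le

lemma sgn_of_neg {t : ℝ} (ht : t < 0) : sgn t = -1 := if_neg ht.not_ge

lemma sgn_eq_one_or (t : ℝ) : sgn t = 1 ∨ sgn t = -1 := by
  unfold sgn; split_ifs <;> simp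

lemma sgn_mul_of_pos {c : ℝ} (hc : 0 < c) (t : ℝ) : sgn (c * t) = sgn t := by
  simp only [sgn, mul_nonneg_iff_of_pos_left hc]

@[fun_prop]
lemma measurable_sgn : Measurable sgn :=
  Measurable.ite measurableSet_Ici measurable_const measurable_const

lemma abs_sgn_mul_sgn (s t : ℝ) : |sgn s * sgn t| = 1 := by
  rcases sgn_eq_one_or s with h | h <;> rcases sgn_eq_one_or t with h' | h' <;> simp [h, h']

lemma integral_sgn_cos_mul_sgn_cos {θ : ℝ} (h0 : 0 ≤ θ) (hπ : θ ≤ π) :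
    ∫ φ in -π..π, sgn (cos φ) * sgn (cos (φ - θ)) = 2 * π - 4 * θ := by
  set g : ℝ → ℝ := fun φ ↦ sgn (cos φ) * sgn (cos (φ - θ)) with hg
  have hper : Function.Periodic g (2 * π) := fun φ ↦ by
    simp only [hg, cos_add_two_pi, add_sub_right_comm]
  have hint (x y : ℝ) : IntervalIntegrable g volume x y := by
    refine (intervalIntegrable_const (c := (1 : ℝ))).mono_fun
      (by fun_prop : Measurable g).aestronglyMeasurable (.of_forall fun φ ↦ ?_)
    simp only [hg, norm_eq_abs, abs_sgn_mul_sgn, abs_one, le_refl]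
  have piece {x y c : ℝ} (hxy : x ≤ y) (h : ∀ φ, x < φ → φ < y → g φ = c) :
      ∫ φ in x..y, g φ = (y - x) * c := by
    rw [intervalIntegral.integral_congr_Ioo_of_le (g := fun _ ↦ c) hxy fun φ hφ ↦ h φ hφ.1 hφ.2]
    simp
  have hpos {φ : ℝ} (h1 : -(π / 2) < φ) (h2 : φ < π / 2) : sgn (cos φ) = 1 :=
    sgn_of_pos (cos_pos_of_mem_Ioo ⟨h1, h2⟩)
  have hneg {φ : ℝ} (h1 : π / 2 < φ) (h2 : φ < π + π / 2) : sgn (cos φ) = -1 :=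
    sgn_of_neg (cos_neg_of_pi_div_two_lt_of_lt h1 h2)
  have hneg' {φ : ℝ} (h1 : -(π + π / 2) < φ) (h2 : φ < -(π / 2)) : sgn (cos φ) = -1 := by
    rw [← cos_neg]; exact hneg (by linarith) (by linarith)
  have hshift := hper.intervalIntegral_add_eq (-π) (-(π / 2))
  rw [show -π + 2 * π = π by ring, show -(π / 2) + 2 * π = π + π / 2 by ring] at hshift
  have e1 : ∫ φ in (-(π / 2))..(-(π / 2) + θ), g φ = _ := piece (c := -1) (by linarith)
    fun φ h1 h2 ↦ by
      simp only [hg]; rw [hpos h1 (by linarith), hneg' (by linarith) (by linarith)]; norm_num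
  have e2 : ∫ φ in (-(π / 2) + θ)..(π / 2), g φ = _ := piece (c := 1) (by linarith)
    fun φ h1 h2 ↦ by
      simp only [hg]; rw [hpos (by linarith) h2, hpos (by linarith) (by linarith)]; norm_num
  have e3 : ∫ φ in (π / 2)..(π / 2 + θ), g φ = _ := piece (c := -1) (by linarith)
    fun φ h1 h2 ↦ by
      simp only [hg]; rw [hneg h1 (by linarith), hpos (by linarith) (by linarith)]; norm_num
  have e4 : ∫ φ in (π / 2 + θ)..(π + π / 2), g φ = _ := piece (c := 1) (by linarith)
    fun φ h1 h2 ↦ by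
      simp only [hg]; rw [hneg (by linarith) h2, hneg (by linarith) (by linarith)]; norm_num
  rw [hshift, ← intervalIntegral.integral_add_adjacent_intervals (hint _ (π / 2 + θ)) (hint _ _),
    ← intervalIntegral.integral_add_adjacent_intervals (hint _ (π / 2)) (hint _ (π / 2 + θ)),
    ← intervalIntegral.integral_add_adjacent_intervals (hint _ (-(π / 2) + θ)) (hint _ (π / 2)),
    e1, e2, e3, e4]
  ring

/-- **Grothendieck's identity** for two unit vectors. -/
lemma integral_sgn_dotp_mul_sgn_dotp {d : ℕ} {a b : Fin d → ℝ} (ha : dotp a a = 1)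
    (hb : dotp b b = 1) (h : |dotp a b| ≤ 1) :
    ∫ r, sgn (dotp r a) * sgn (dotp r b) ∂gaussPi d = 1 - 2 * (arccos (dotp a b) / π) := by
  set θ := arccos (dotp a b) with hθ
  have hcos : cos θ = dotp a b := cos_arccos (abs_le.1 h).1 (abs_le.1 h).2
  have hmap := map_dotp_prod_eq (a := a) (b := b) (a' := ![1, 0]) (b' := ![cos θ, sin θ])
    (by rw [ha]; simp [dotp]) (by simp [hcos, dotp])
    (by rw [hb]; simp [dotp, ← sq])
  have hmeas : Measurable fun p : ℝ × ℝ ↦ sgn p.1 * sgn p.2 := by fun_prop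
  calc
    _ = ∫ p, sgn p.1 * sgn p.2 ∂(gaussPi d).map fun r ↦ (dotp r a, dotp r b) :=
      (integral_map (by fun_prop) hmeas.aestronglyMeasurable).symm
    _ = ∫ r, sgn (r 0) * sgn (r 0 * cos θ + r 1 * sin θ) ∂gaussPi 2 := by
      rw [hmap, integral_map (by fun_prop) hmeas.aestronglyMeasurable]
      simp [dotp]
    _ = ∫ p, sgn p.1 * sgn (p.1 * cos θ + p.2 * sin θ)
          ∂((gaussianReal 0 1).prod (gaussianReal 0 1)) := by
      rw [← (measurePreserving_finTwoArrow (gaussianReal 0 1)).integral_comp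
        MeasurableEquiv.finTwoArrow.measurableEmbedding]
      rfl
    _ = (2 * π)⁻¹ * ∫ φ in -π..π, sgn (cos φ) * sgn (cos (φ - θ)) := by
      refine integral_gaussianReal_prod_of_radially_const fun ρ hρ φ ↦ ?_
      have : ρ * cos φ * cos θ + ρ * sin φ * sin θ = ρ * cos (φ - θ) := by rw [cos_sub]; ring
      simp only [this, sgn_mul_of_pos hρ]
    _ = _ := by
      rw [integral_sgn_cos_mul_sgn_cos (arccos_nonneg _) (arccos_le_pi _)]
      have := pi_ne_zero
      field_simp
      ring

lemma integrable_of_measurable_of_abs_le {α : Type*} [MeasurableSpace α] {μ : Measure α}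
    [IsFiniteMeasure μ] {f : α → ℝ} (hf : Measurable f) {C : ℝ} (h : ∀ x, |f x| ≤ C) :
    Integrable f μ :=
  .of_bound hf.aestronglyMeasurable C (.of_forall h)

lemma integrable_sgn_dotp_mul_sgn_dotp {d : ℕ} (a b : Fin d → ℝ) :
    Integrable (fun r ↦ sgn (dotp r a) * sgn (dotp r b)) (gaussPi d) :=
  integrable_of_measurable_of_abs_le (by fun_prop) fun _ ↦ (abs_sgn_mul_sgn _ _).le

lemma integral_sign_disagreement {d : ℕ} {a b : Fin d → ℝ} (ha : dotp a a = 1)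
    (hb : dotp b b = 1) (h : |dotp a b| ≤ 1) :
    ∫ r, (1 - sgn (dotp r a) * sgn (dotp r b)) / 2 ∂gaussPi d = arccos (dotp a b) / π := by
  rw [integral_div, integral_sub (integrable_const _) (integrable_sgn_dotp_mul_sgn_dotp a b),
    integral_sgn_dotp_mul_sgn_dotp ha hb h]
  simp

lemma l2norm_eq_sqrt_dotp {d : ℕ} (x : Fin d → ℝ) : l2norm x = √(dotp x x) := by
  simp [l2norm, dotp, sq]

lemma dotp_self_nonneg {d : ℕ} (x : Fin d → ℝ) : 0 ≤ dotp x x :=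
  Finset.sum_nonneg fun _ _ ↦ mul_self_nonneg _

lemma dotp_self_of_l2norm_eq_one {d : ℕ} {x : Fin d → ℝ} (h : l2norm x = 1) : dotp x x = 1 := by
  rwa [l2norm_eq_sqrt_dotp, sqrt_eq_one] at h

lemma abs_dotp_le_one {d : ℕ} {x y : Fin d → ℝ} (hx : dotp x x = 1) (hy : dotp y y = 1) :
    |dotp x y| ≤ 1 := by
  have h := Finset.sum_mul_sq_le_sq_mul_sq Finset.univ x y
  rw [← sq_le_one_iff_abs_le_one]
  simp only [dotp, ← sq] at *
  rwa [hx, hy, one_mul] at h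

lemma arcsin_le_pi_div_two_mul {x : ℝ} (h0 : 0 ≤ x) (h1 : x ≤ 1) : arcsin x ≤ π / 2 * x := by
  have h := mul_le_sin (arcsin_nonneg.2 h0) (arcsin_le_pi_div_two x)
  rw [sin_arcsin (by linarith) h1] at h
  calc arcsin x = π / 2 * (2 / π * arcsin x) := by field_simp
    _ ≤ π / 2 * x := by gcongr

/-- A Gaussian separates a unit vector `u` from its component `u - p` orthogonal to `p`
with probability at most `‖p‖ / 2`. -/
lemma integral_sign_disagreement_sub_le {d : ℕ} {u p : Fin d → ℝ} (hu : dotp u u = 1)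
    (hp : dotp (u - p) p = 0) (hlt : l2norm p < 1) :
    ∫ r, (1 - sgn (dotp r u) * sgn (dotp r (u - p))) / 2 ∂gaussPi d ≤ l2norm p / 2 := by
  set w := u - p with hw
  have hpn : l2norm p ^ 2 = dotp p p := by
    rw [l2norm_eq_sqrt_dotp, sq_sqrt (dotp_self_nonneg p)]
  have hp0 : 0 ≤ l2norm p := sqrt_nonneg _
  have hup : dotp u p = dotp p p := by
    rw [hw, dotp_sub_left] at hp; linarith
  have huw : dotp u w = 1 - l2norm p ^ 2 := by
    rw [dotp_comm, hw, dotp_sub_left, hu, dotp_comm, hup, hpn]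
  have hww : dotp w w = 1 - l2norm p ^ 2 := by
    nth_rw 1 [hw]; rw [dotp_sub_left, huw, dotp_comm p, hp, sub_zero]
  have hpos : 0 < 1 - l2norm p ^ 2 := by nlinarith
  set n := √(1 - l2norm p ^ 2) with hn
  have hn0 : 0 < n := sqrt_pos.2 hpos
  have hnn : n * n = 1 - l2norm p ^ 2 := mul_self_sqrt hpos.le
  have hunit : dotp (n⁻¹ • w) (n⁻¹ • w) = 1 := by
    rw [dotp_smul_right, dotp_comm, dotp_smul_right, hww, ← hnn]
    field_simp
  have hun : dotp u (n⁻¹ • w) = n := by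
    rw [dotp_smul_right, huw, ← hnn]
    field_simp
  have h := integral_sign_disagreement hu hunit (abs_dotp_le_one hu hunit)
  simp only [dotp_smul_right _ _ w, sgn_mul_of_pos (inv_pos.2 hn0)] at h
  rw [h, ← dotp_smul_right, hun, hn, ← arcsin_eq_arccos hp0, div_le_iff₀ pi_pos]
  linarith [arcsin_le_pi_div_two_mul hp0 hlt.le]

lemma dotp_eq_zero_of_mem_span_pair {d : ℕ} {a b p x : Fin d → ℝ}
    (hp : p ∈ Submodule.span ℝ ({a, b} : Set (Fin d → ℝ))) (ha : dotp x a = 0)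
    (hb : dotp x b = 0) : dotp x p = 0 := by
  obtain ⟨s, t, rfl⟩ := Submodule.mem_span_pair.1 hp
  rw [dotp_add_right, dotp_smul_right, dotp_smul_right, ha, hb]
  simp

lemma abs_centered_sign_disagreement_le_one {t : ℝ} (h0 : 0 ≤ t) (h1 : t ≤ 1) (x y : ℝ) :
    |(1 - sgn x * sgn y) / 2 - t| ≤ 1 := by
  rw [abs_le]
  rcases sgn_eq_one_or x with h | h <;> rcases sgn_eq_one_or y with h' | h' <;> rw [h, h'] <;>
    constructor <;> linarith

lemma sign_disagreement_sub_le (x y x' y' : ℝ) :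
    |(1 - sgn x * sgn y) / 2 - (1 - sgn x' * sgn y') / 2| ≤
      (1 - sgn x * sgn x') / 2 + (1 - sgn y * sgn y') / 2 := by
  rcases sgn_eq_one_or x with h1 | h1 <;> rcases sgn_eq_one_or y with h2 | h2 <;>
    rcases sgn_eq_one_or x' with h3 | h3 <;> rcases sgn_eq_one_or y' with h4 | h4 <;>
    rw [h1, h2, h3, h4] <;> norm_num

/-- For unit vectors `a, b, u, v` with `∠(a,b) = ∠(u,v) = θ`, if the orthogonal projections of
`u` and `v` onto `span{a,b}` have norms with maximum `δ < 1` (the projections being characterized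
by membership in the span and orthogonality of the residual to `a` and `b`), then
`E[((1 − sign⟨r,a⟩sign⟨r,b⟩)/2 − θ/π)((1 − sign⟨r,u⟩sign⟨r,v⟩)/2 − θ/π)] ≤ 2δ`. -/
theorem stmt9 {d : ℕ} (a b u v : Fin d → ℝ)
    (ha : l2norm a = 1) (hb : l2norm b = 1) (hu : l2norm u = 1) (hv : l2norm v = 1)
    (θ : ℝ) (hab : angle' a b = θ) (huv : angle' u v = θ)
    (pu pv : Fin d → ℝ)
    (hpu : pu ∈ Submodule.span ℝ ({a, b} : Set (Fin d → ℝ)))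
    (hpv : pv ∈ Submodule.span ℝ ({a, b} : Set (Fin d → ℝ)))
    (hpu' : dotp (u - pu) a = 0 ∧ dotp (u - pu) b = 0)
    (hpv' : dotp (v - pv) a = 0 ∧ dotp (v - pv) b = 0)
    (δ : ℝ) (hδmax : max (l2norm pu) (l2norm pv) = δ) (hδ : δ < 1) :
    (∫ r, ((1 - sgn (dotp r a) * sgn (dotp r b)) / 2 - θ / π) *
          ((1 - sgn (dotp r u) * sgn (dotp r v)) / 2 - θ / π) ∂(gaussPi d)) ≤ 2 * δ := by
  have ha := dotp_self_of_l2norm_eq_one ha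
  have hb := dotp_self_of_l2norm_eq_one hb
  have hlu : l2norm pu ≤ δ := hδmax ▸ le_max_left _ _
  have hlv : l2norm pv ≤ δ := hδmax ▸ le_max_right _ _
  have hδ0 : 0 ≤ δ := (sqrt_nonneg _).trans hlu
  have hθ : arccos (dotp a b) = θ := by simpa [angle', *] using hab
  have ht0 : 0 ≤ θ / π := hθ ▸ div_nonneg (arccos_nonneg _) pi_pos.le
  have ht1 : θ / π ≤ 1 := hθ ▸ div_le_one_of_le₀ (arccos_le_pi _) pi_pos.le
  have hu := dotp_self_of_l2norm_eq_one hu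
  have hv := dotp_self_of_l2norm_eq_one hv
  set t := θ / π with ht
  set f : (x y : ℝ) → ℝ := fun x y ↦ (1 - sgn x * sgn y) / 2 - t with hf
  have hfm : Measurable fun p : ℝ × ℝ ↦ f p.1 p.2 := by fun_prop
  have hfle (x y : ℝ) : |f x y| ≤ 1 := abs_centered_sign_disagreement_le_one ht0 ht1 x y
  have hfi (x y : Fin d → ℝ) : Integrable (fun r ↦ f (dotp r x) (dotp r y)) (gaussPi d) :=
    integrable_of_measurable_of_abs_le (by fun_prop) fun _ ↦ hfle _ _
  have hprod (x y x' y' : Fin d → ℝ) : Integrable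
      (fun r ↦ f (dotp r x) (dotp r y) * f (dotp r x') (dotp r y')) (gaussPi d) :=
    integrable_of_measurable_of_abs_le (C := 1) (by fun_prop) fun _ ↦ by
      rw [abs_mul]; exact mul_le_one₀ (hfle _ _) (abs_nonneg _) (hfle _ _)
  have hdis (x y : Fin d → ℝ) :
      Integrable (fun r ↦ (1 - sgn (dotp r x) * sgn (dotp r y)) / 2) (gaussPi d) :=
    ((integrable_const 1).sub (integrable_sgn_dotp_mul_sgn_dotp x y)).div_const 2
  have hmean : ∫ r, f (dotp r a) (dotp r b) ∂gaussPi d = 0 := by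
    simp only [hf]
    rw [integral_sub (hdis a b) (integrable_const _),
      integral_sign_disagreement ha hb (abs_dotp_le_one ha hb), hθ]
    simp [ht]
  have hind : ∫ r, f (dotp r a) (dotp r b) * f (dotp r (u - pu)) (dotp r (v - pv)) ∂gaussPi d
      = 0 := by
    have hi := indepFun_dotp_prod ((dotp_comm _ _).trans hpu'.1) ((dotp_comm _ _).trans hpv'.1)
      ((dotp_comm _ _).trans hpu'.2) ((dotp_comm _ _).trans hpv'.2)
    have := (hi.comp hfm hfm).integral_fun_mul_eq_mul_integral
      (hfi _ _).aestronglyMeasurable (hfi _ _).aestronglyMeasurable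
    simp only [Function.comp_apply] at this
    rw [this, hmean, zero_mul]
  have hbu := integral_sign_disagreement_sub_le hu
    (dotp_eq_zero_of_mem_span_pair hpu hpu'.1 hpu'.2) (hlu.trans_lt hδ)
  have hbv := integral_sign_disagreement_sub_le hv
    (dotp_eq_zero_of_mem_span_pair hpv hpv'.1 hpv'.2) (hlv.trans_lt hδ)
  calc
    _ = ∫ r, (f (dotp r a) (dotp r b) * f (dotp r u) (dotp r v) -
          f (dotp r a) (dotp r b) * f (dotp r (u - pu)) (dotp r (v - pv))) ∂gaussPi d := by
      rw [integral_sub (hprod _ _ _ _) (hprod _ _ _ _), hind, sub_zero]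
    _ ≤ ∫ r, ((1 - sgn (dotp r u) * sgn (dotp r (u - pu))) / 2 +
          (1 - sgn (dotp r v) * sgn (dotp r (v - pv))) / 2) ∂gaussPi d := by
      refine integral_mono ((hprod _ _ _ _).sub (hprod _ _ _ _)) ((hdis _ _).add (hdis _ _))
        fun r ↦ ?_
      have h1 := sign_disagreement_sub_le (dotp r u) (dotp r v) (dotp r (u - pu)) (dotp r (v - pv))
      refine le_trans ?_ h1
      rw [← mul_sub]
      refine (le_abs_self _).trans ?_
      rw [abs_mul, hf, sub_sub_sub_cancel_right]
      exact mul_le_of_le_one_left (abs_nonneg _) (hfle _ _)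
    _ ≤ 2 * δ := by
      rw [integral_add (hdis _ _) (hdis _ _)]
      linarith

end
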